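/- Let K be a complete discretely valued field with perfect residue field of characteristic p > 0, and let L_n/K be a cyclic totally ramified extension of degree p^n. For 0 ≤ i ≤ n let L_i be the unique intermediate field with [L_i : K] = p^i, and set m_i = m(L_i/K), e_i = e(L_i/K), μ_i = μ(L_i/K) (with m_0 = e_0 = μ_0 = 0). Then e_n = Σ_{i=1}^{n} p^{i−1}(m_i − m_{i−1}) and μ_n = Σ_{i=1}^{n} (p^i − p^{i−1}) m_i. -/

import Mathlib

/-- A (rank-one) additive valuation on a field, written additively with value `⊤` at `0`. -/
def IsAddValuation {L : Type*} [Field L] (v : L → WithTop ℤ) : Prop :=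
  (∀ x, v x = ⊤ ↔ x = 0) ∧ (∀ x y, v (x * y) = v x + v y) ∧
    (∀ x y, min (v x) (v y) ≤ v (x + y))

/-- The `i`-th lower ramification group `Γ_i = {σ : v(σt − t) ≥ i + 1}` of a Galois extension,
computed with respect to a valuation `v` and a uniformizer `t`. -/
def ramGroup {K L : Type*} [Field K] [Field L] [Algebra K L] (v : L → WithTop ℤ) (t : L)
    (i : ℕ) : Set (L ≃ₐ[K] L) :=
  {σ | (((i : ℤ) + 1 : ℤ) : WithTop ℤ) ≤ v (σ t - t)}

section Ramification

open Polynomial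

/-- A uniformizer `t` for a valuation on `E` under which `E/K` is totally ramified. -/
def IsTotRamUniformizer (K : Type*) {E : Type*} [Field K] [Field E] [Algebra K E]
    (w : AddValuation E (WithTop ℤ)) (t : E) : Prop :=
  w t = 1 ∧ ∀ x : K, x ≠ 0 → ∃ a : ℤ,
    w (algebraMap K E x) = ((Module.finrank K E * a : ℤ) : WithTop ℤ)

namespace AddValuation

variable {E : Type*} [Field E] (w : AddValuation E (WithTop ℤ))

theorem map_prod_withTop {ι : Type*} (s : Finset ι) (f : ι → E) :
    w (∏ i ∈ s, f i) = ∑ i ∈ s, w (f i) := by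
  classical
  induction s using Finset.induction_on with
  | empty => simp
  | insert a s ha ih => rw [Finset.prod_insert ha, Finset.sum_insert ha, map_mul, ih]

theorem aeval_nonneg {K : Type*} [Field K] [Algebra K E] {g : K[X]} {y : E}
    (hg : ∀ k, 0 ≤ w (algebraMap K E (g.coeff k))) (hy : 0 ≤ w y) : 0 ≤ w (aeval y g) := by
  rw [aeval_eq_sum_range]
  refine w.map_le_sum fun k _ => ?_
  rw [Algebra.smul_def, map_mul, map_pow]
  exact add_nonneg (hg k) (nsmul_nonneg hy k)

theorem map_sub_le_map_aeval_sub {K : Type*} [Field K] [Algebra K E] {g : K[X]} {x y : E}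
    (hg : ∀ k, 0 ≤ w (algebraMap K E (g.coeff k))) (hx : 0 ≤ w x) (hy : 0 ≤ w y) :
    w (x - y) ≤ w (aeval x g - aeval y g) := by
  rw [aeval_eq_sum_range, aeval_eq_sum_range, ← Finset.sum_sub_distrib]
  refine w.map_le_sum fun k _ => ?_
  rw [← smul_sub, Algebra.smul_def, map_mul, ← (Commute.all x y).mul_geom_sum₂, map_mul]
  refine le_add_of_nonneg_of_le (hg k) (le_add_of_nonneg_right (w.map_le_sum fun i _ => ?_))
  rw [map_mul, map_pow, map_pow]
  exact add_nonneg (nsmul_nonneg hx _) (nsmul_nonneg hy _)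

theorem sum_map_sub_le_map_eval {P : E[X]} (hP : ∀ k, 0 ≤ w (P.coeff k)) {ι : Type*}
    {s : Finset ι} {r : ι → E} (hinj : Set.InjOn r s) (hr : ∀ i ∈ s, 0 ≤ w (r i))
    (hroot : ∀ i ∈ s, P.IsRoot (r i)) {y : E} (hy : 0 ≤ w y) :
    ∑ i ∈ s, w (y - r i) ≤ w (P.eval y) := by
  classical
  induction s using Finset.induction_on generalizing P with
  | empty =>
    rw [Finset.sum_empty, eval_eq_sum_range]
    refine w.map_le_sum fun k _ => ?_
    rw [map_mul, map_pow]
    exact add_nonneg (hP k) (nsmul_nonneg hy k)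
  | insert a s ha ih =>
    let O := (toValuation w).integer
    have hPO : (↑P.coeffs : Set E) ⊆ O := by
      intro c hc
      obtain ⟨k, -, rfl⟩ := mem_coeffs_iff.1 hc
      exact hP k
    have hroot' : (P.toSubring O hPO).IsRoot ⟨r a, hr a (by simp)⟩ := by
      have h := hroot a (by simp)
      rw [← map_toSubring P O hPO] at h
      exact IsRoot.of_map (f := O.subtype) (x := (⟨r a, hr a (by simp)⟩ : O)) h
        Subtype.val_injective
    obtain ⟨Q, hQ⟩ := dvd_iff_isRoot.2 hroot'
    have hPQ : P = (X - C (r a)) * Q.map O.subtype := by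
      rw [← map_toSubring P O hPO, hQ, Polynomial.map_mul]
      simp
    rw [Finset.sum_insert ha, hPQ, eval_mul, map_mul]
    simp only [eval_sub, eval_X, eval_C]
    gcongr
    refine ih (fun k => ?_) (hinj.mono (by simp)) (fun i hi => hr i (by simp [hi])) fun i hi => ?_
    · rw [coeff_map]
      exact (Q.coeff k).2
    · have h := hroot i (by simp [hi])
      rw [hPQ, IsRoot.def, eval_mul, mul_eq_zero] at h
      refine h.resolve_left fun h0 => ha ?_
      have : r i = r a := by simpa [sub_eq_zero] using h0
      rwa [← hinj (by simp [hi]) (by simp) this]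

end AddValuation

theorem Polynomial.Monic.eval_eq_prod_of_isRoot {E : Type*} [Field E] {P : E[X]} (hP : P.Monic)
    {ι : Type*} {s : Finset ι} {r : ι → E} (hinj : Set.InjOn r s)
    (hroot : ∀ i ∈ s, P.IsRoot (r i)) (hcard : P.natDegree = s.card) (y : E) :
    P.eval y = ∏ i ∈ s, (y - r i) := by
  have hprod : P = ∏ i ∈ s, (X - C (r i)) := by
    refine eq_of_monic_of_dvd_of_natDegree_le (monic_prod_X_sub_C _ _) hP ?_ ?_
    · refine Finset.prod_dvd_of_coprime (fun i hi j hj hne => ?_) fun i hi =>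
        dvd_iff_isRoot.2 (hroot i hi)
      exact isCoprime_X_sub_C_of_isUnit_sub
        (sub_ne_zero.2 fun h => hne (hinj hi hj h)).isUnit
    · rw [hcard, natDegree_prod_of_monic _ _ fun i _ => monic_X_sub_C _]
      simp
  rw [hprod, eval_prod]
  simp only [eval_sub, eval_X, eval_C]

namespace IsTotRamUniformizer

variable {K E : Type*} [Field K] [Field E] [Algebra K E] {w : AddValuation E (WithTop ℤ)} {t : E}

theorem map_mul_pow (h : IsTotRamUniformizer K w t) {a : K} (ha : a ≠ 0) (j : ℕ) : ∃ c : ℤ,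
    w (algebraMap K E a) = ((Module.finrank K E * c : ℤ) : WithTop ℤ) ∧
    w (algebraMap K E a * t ^ j) = ((Module.finrank K E * c + j : ℤ) : WithTop ℤ) := by
  obtain ⟨c, hc⟩ := h.2 a ha
  refine ⟨c, hc, ?_⟩
  rw [w.map_mul, w.map_pow, hc, h.1]
  simp

theorem map_sum_le (h : IsTotRamUniformizer K w t) (a : ℕ → K) {j : ℕ}
    (hj : j ∈ Finset.range (Module.finrank K E)) :
    w (∑ k ∈ Finset.range (Module.finrank K E), algebraMap K E (a k) * t ^ k) ≤
      w (algebraMap K E (a j) * t ^ j) := by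
  set N := Module.finrank K E with hN
  obtain ⟨i, hi, hmin⟩ := Finset.exists_min_image (Finset.range N)
    (fun k => w (algebraMap K E (a k) * t ^ k)) ⟨j, hj⟩
  by_cases hai : a i = 0
  · have := hmin j hj
    simp only [hai, _root_.map_zero, zero_mul, AddValuation.map_zero, top_le_iff] at this
    rw [this]; exact le_top
  refine le_trans (le_of_eq ?_) (hmin j hj)
  obtain ⟨c, -, hc⟩ := h.map_mul_pow hai i
  rw [← Finset.add_sum_erase _ _ hi]
  refine w.map_add_eq_of_lt_left (w.map_lt_sum (by rw [hc]; exact WithTop.coe_ne_top) ?_)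
  intro k hk
  rw [Finset.mem_erase] at hk
  refine lt_of_le_of_ne (hmin k hk.2) ?_
  by_cases hak : a k = 0
  · rw [hak, hc]
    simp only [_root_.map_zero, zero_mul, w.map_zero]
    exact WithTop.coe_ne_top
  obtain ⟨c', -, hc'⟩ := h.map_mul_pow hak k
  rw [hc, hc', ← hN]
  intro heq
  have heq : (N * c + i : ℤ) = N * c' + k := WithTop.coe_injective heq
  have h1 := hk.2
  rw [Finset.mem_range] at h1 hi
  have : (i : ℤ) % N = k % N := by
    have := congrArg (· % (N : ℤ)) heq
    simpa using this
  rw [Int.emod_eq_of_lt (by positivity) (by omega), Int.emod_eq_of_lt (by positivity) (by omega)]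
    at this
  exact hk.1 (by omega)

variable [FiniteDimensional K E]

theorem exists_aeval_eq (h : IsTotRamUniformizer K w t) {y : E} (hy : 0 ≤ w y) :
    ∃ g : K[X], g.degree < Module.finrank K E ∧ (∀ k, 0 ≤ w (algebraMap K E (g.coeff k))) ∧
      aeval t g = y := by
  set N := Module.finrank K E with hN
  have hli : LinearIndependent K fun i : Fin N => t ^ (i : ℕ) := by
    rw [Fintype.linearIndependent_iff]
    intro a ha i
    have := h.map_sum_le (fun k => if hk : k < N then a ⟨k, hk⟩ else 0) (j := i) (by simp [← hN])
    rw [← hN, Finset.sum_range] at this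
    simp only [Fin.is_lt, dite_true, Fin.eta] at this
    simp only [Algebra.smul_def] at ha
    rw [ha, AddValuation.map_zero, top_le_iff, w.top_iff] at this
    by_contra hai
    have h0 : t ≠ 0 := by
      rw [← w.ne_top_iff, h.1]; exact WithTop.coe_ne_top
    simp [hai, h0] at this
  have hspan := hli.span_eq_top_of_card_eq_finrank' (by simp [← hN])
  have hmem : y ∈ Submodule.span K (Set.range fun i : Fin N => t ^ (i : ℕ)) := by
    rw [hspan]; trivial
  obtain ⟨a, rfl⟩ := (Submodule.mem_span_range_iff_exists_fun K).1 hmem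
  let b : ℕ → K := fun k => if hk : k < N then a ⟨k, hk⟩ else 0
  have hb : ∑ i, a i • t ^ (i : ℕ) = ∑ k ∈ Finset.range N, algebraMap K E (b k) * t ^ k := by
    rw [Finset.sum_range]
    simp [b, Algebra.smul_def]
  have hcoeff : ∀ k, (∑ i ∈ Finset.range N, C (b i) * X ^ i : K[X]).coeff k = b k := by
    intro k
    simp only [finsetSum_coeff, coeff_C_mul, coeff_X_pow, mul_ite, mul_one, mul_zero]
    rw [Finset.sum_ite_eq]
    by_cases hk : k < N <;> simp [hk, b]
  refine ⟨∑ i ∈ Finset.range N, C (b i) * X ^ i, ?_, fun k => ?_, ?_⟩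
  · rw [degree_lt_iff_coeff_zero]
    intro k hk
    rw [hcoeff]
    simp [b, not_lt.2 hk]
  · rw [hcoeff]
    by_cases hbk : b k = 0
    · simp [hbk]
    have hk : k < N := by
      by_contra hk
      simp [b, hk] at hbk
    have h1 := h.map_sum_le b (Finset.mem_range.2 hk)
    rw [← hN, ← hb] at h1
    obtain ⟨c, hc, hc'⟩ := h.map_mul_pow hbk k
    rw [hc'] at h1
    have h2 := hy.trans h1
    rw [hc]
    norm_cast at h2 ⊢
    rw [← hN] at h2 ⊢
    by_contra! hneg
    have : c < 0 := by
      by_contra! hc0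
      exact absurd hneg (not_lt.2 (by positivity))
    nlinarith
  · rw [hb, map_sum]
    simp

theorem eq_one_of_apply_eq (h : IsTotRamUniformizer K w t) {σ : E ≃ₐ[K] E} (hσ : σ t = t) :
    σ = 1 := by
  have key : ∀ y, 0 ≤ w y → σ y = y := by
    intro y hy
    obtain ⟨g, -, -, rfl⟩ := h.exists_aeval_eq hy
    rw [← Polynomial.aeval_algHom_apply, hσ]
  ext y
  rcases le_total 0 (w y) with hy | hy
  · exact key y hy
  · have h1 : 0 ≤ w y⁻¹ := by
      by_cases h0 : y = 0
      · simp [h0]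
      obtain ⟨c, hc⟩ := WithTop.ne_top_iff_exists.1 ((w.ne_top_iff).2 h0)
      obtain ⟨c', hc'⟩ := WithTop.ne_top_iff_exists.1 ((w.ne_top_iff).2 (inv_ne_zero h0))
      have h2 : w y + w y⁻¹ = 0 := by rw [← w.map_mul, mul_inv_cancel₀ h0, w.map_one]
      rw [← hc, ← hc'] at h2
      rw [← hc] at hy
      rw [← hc']
      norm_cast at *
      omega
    have := key _ h1
    rw [map_inv₀] at this
    exact inv_injective this

theorem injective_apply (h : IsTotRamUniformizer K w t) :
    Function.Injective fun σ : E ≃ₐ[K] E => σ t := by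
  intro s s' hss
  have : (s'⁻¹ * s) t = t := by
    rw [AlgEquiv.mul_apply, show s t = s' t from hss]
    exact s'.symm_apply_apply t
  exact (inv_mul_eq_one.1 (h.eq_one_of_apply_eq this)).symm

theorem map_apply_uniformizer_nonneg (h : IsTotRamUniformizer K w t) (σ : E ≃ₐ[K] E) :
    0 ≤ w (σ t) := by
  set N := Module.finrank K E with hN
  have hNpos : 0 < N := Module.finrank_pos
  have ht0 : t ≠ 0 := by
    rw [← w.ne_top_iff, h.1]; exact WithTop.coe_ne_top
  obtain ⟨g, hg, hg0, hgt⟩ := h.exists_aeval_eq (y := t ^ N) (by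
    rw [w.map_pow, h.1]; exact nsmul_nonneg zero_le_one _)
  by_contra! hneg
  have hσt : σ t ≠ 0 := σ.map_ne_zero_iff.2 ht0
  obtain ⟨c, hc⟩ := WithTop.ne_top_iff_exists.1 ((w.ne_top_iff).2 hσt)
  have h1 : aeval (σ t) g = σ t ^ N := by
    rw [Polynomial.aeval_algHom_apply, hgt, map_pow]
  have hdeg : g.natDegree < N := by
    by_cases hg' : g = 0
    · simpa [hg'] using hNpos
    · exact (natDegree_lt_iff_degree_lt hg').2 hg
  have h2 : ((((N : ℤ) - 1) * c : ℤ) : WithTop ℤ) ≤ w (aeval (σ t) g) := by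
    rw [aeval_eq_sum_range]
    refine w.map_le_sum fun k hk => ?_
    rw [Finset.mem_range] at hk
    rw [Algebra.smul_def, w.map_mul, w.map_pow, ← hc]
    refine le_add_of_nonneg_of_le (hg0 k) ?_
    rw [← hc] at hneg
    norm_cast at hneg ⊢
    rw [nsmul_eq_mul]
    have : (k : ℤ) ≤ N - 1 := by omega
    exact mul_le_mul_of_nonpos_right this hneg.le
  rw [h1, w.map_pow, ← hc, ← WithTop.coe_nsmul, WithTop.coe_le_coe, nsmul_eq_mul] at h2
  rw [← hc] at hneg
  norm_cast at hneg
  linarith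

theorem map_apply_nonneg (h : IsTotRamUniformizer K w t) (σ : E ≃ₐ[K] E) {y : E} (hy : 0 ≤ w y) :
    0 ≤ w (σ y) := by
  obtain ⟨g, -, hg0, rfl⟩ := h.exists_aeval_eq hy
  rw [← Polynomial.aeval_algHom_apply]
  exact w.aeval_nonneg hg0 (h.map_apply_uniformizer_nonneg σ)

theorem one_le_map_apply (h : IsTotRamUniformizer K w t) (σ : E ≃ₐ[K] E) : 1 ≤ w (σ t) := by
  by_contra! hlt
  have ht0 : t ≠ 0 := by
    rw [← w.ne_top_iff, h.1]; exact WithTop.coe_ne_top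
  have hσt : σ t ≠ 0 := σ.map_ne_zero_iff.2 ht0
  have inv_val : ∀ x : E, x ≠ 0 → w x + w x⁻¹ = 0 := fun x hx => by
    rw [← w.map_mul, mul_inv_cancel₀ hx, w.map_one]
  obtain ⟨c, hc⟩ := WithTop.ne_top_iff_exists.1 ((w.ne_top_iff).2 hσt)
  obtain ⟨c', hc'⟩ := WithTop.ne_top_iff_exists.1 ((w.ne_top_iff).2 (inv_ne_zero hσt))
  obtain ⟨d, hd⟩ := WithTop.ne_top_iff_exists.1 ((w.ne_top_iff).2 (inv_ne_zero ht0))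
  have h1 := inv_val _ hσt
  have h2 := inv_val _ ht0
  rw [h.1, ← hd] at h2
  rw [← hc, ← hc'] at h1
  rw [← hc] at hlt
  have h3 : 0 ≤ w (σ.symm (σ t)⁻¹) := h.map_apply_nonneg _ (by
    rw [← hc']
    norm_cast at *
    omega)
  rw [map_inv₀, σ.symm_apply_apply, ← hd] at h3
  norm_cast at *
  omega

theorem le_map_apply (h : IsTotRamUniformizer K w t) (σ : E ≃ₐ[K] E) {y : E} (hy : 0 ≤ w y) :
    w y ≤ w (σ y) := by
  by_cases h0 : y = 0
  · simp [h0]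
  have ht0 : t ≠ 0 := by
    rw [← w.ne_top_iff, h.1]; exact WithTop.coe_ne_top
  obtain ⟨c, hc⟩ := WithTop.ne_top_iff_exists.1 ((w.ne_top_iff).2 h0)
  rw [← hc] at hy ⊢
  norm_cast at hy
  lift c to ℕ using hy
  obtain ⟨z, rfl⟩ : ∃ z, y = z * t ^ c := ⟨y / t ^ c, by field_simp⟩
  rw [w.map_mul, w.map_pow, h.1] at hc
  have hz : 0 ≤ w z := by
    obtain ⟨d, hd⟩ := WithTop.ne_top_iff_exists.1 ((w.ne_top_iff).2 (left_ne_zero_of_mul h0))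
    rw [← hd] at hc ⊢
    have hc : (((c : ℕ) : ℤ) : WithTop ℤ) = ((d + c : ℤ) : WithTop ℤ) := by simpa using hc
    norm_cast at *
    omega
  rw [_root_.map_mul, _root_.map_pow, w.map_mul, w.map_pow]
  refine le_add_of_nonneg_of_le (h.map_apply_nonneg σ hz) ?_
  calc (((c : ℕ) : ℤ) : WithTop ℤ) = c • (1 : WithTop ℤ) := by simp
    _ ≤ _ := nsmul_le_nsmul_right (h.one_le_map_apply σ) c

end IsTotRamUniformizer

namespace IsTotRamUniformizer

section Tower

theorem map_sub_le {K F : Type*} [Field K] [Field F] [Algebra K F]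
    {wF : AddValuation F (WithTop ℤ)} {tF : F} (hF : IsTotRamUniformizer K wF tF)
    [FiniteDimensional K F] (τ : F ≃ₐ[K] F)
    {y : F} (hy : 0 ≤ wF y) : wF (τ tF - tF) ≤ wF (τ y - y) := by
  obtain ⟨g, -, hg, rfl⟩ := hF.exists_aeval_eq hy
  rw [← Polynomial.aeval_algHom_apply]
  exact wF.map_sub_le_map_aeval_sub hg (hF.map_apply_uniformizer_nonneg τ)
    (by rw [hF.1]; exact zero_le_one)

theorem of_tower {K F E : Type*} [Field K] [Field F] [Field E] [Algebra F E] [Algebra K E]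
    {wE : AddValuation E (WithTop ℤ)} {tE : E} {wF : AddValuation F (WithTop ℤ)}
    (hE : IsTotRamUniformizer K wE tE)
    (hcomp : ∀ x, wE (algebraMap F E x) = Module.finrank F E • wF x) :
    IsTotRamUniformizer F wE tE := by
  refine ⟨hE.1, fun x hx => ?_⟩
  obtain ⟨c, hc⟩ := WithTop.ne_top_iff_exists.1 ((wF.ne_top_iff).2 hx)
  exact ⟨c, by rw [hcomp, ← hc, ← WithTop.coe_nsmul, nsmul_eq_mul]⟩

variable {K F E : Type*} [Field K] [Field F] [Field E] [Algebra K F] [Algebra F E] [Algebra K E]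
  [IsScalarTower K F E] [FiniteDimensional K E] {wE : AddValuation E (WithTop ℤ)} {tE : E}
  {wF : AddValuation F (WithTop ℤ)} {tF : F} [IsGalois K F]

theorem card_fiber_restrictNormalHom [IsGalois K E] [FiniteDimensional K F]
    [DecidableEq (F ≃ₐ[K] F)]
    (τ : F ≃ₐ[K] F) :
    (Finset.univ.filter fun s : E ≃ₐ[K] E => AlgEquiv.restrictNormalHom F s = τ).card =
      Module.finrank F E := by
  have hsurj : Function.Surjective (AlgEquiv.restrictNormalHom F : (E ≃ₐ[K] E) →* _) :=
    AlgEquiv.restrictNormalHom_surjective E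
  have h1 : Fintype.card (E ≃ₐ[K] E) = Fintype.card (F ≃ₐ[K] F) *
      (Finset.univ.filter fun s : E ≃ₐ[K] E => AlgEquiv.restrictNormalHom F s = τ).card := by
    rw [← Finset.card_univ, Finset.card_eq_sum_card_fiberwise
      (f := AlgEquiv.restrictNormalHom F) (t := Finset.univ) (by simp)]
    rw [Finset.sum_congr rfl fun x _ => MonoidHom.card_fiber_eq_of_mem_range
      (AlgEquiv.restrictNormalHom F : (E ≃ₐ[K] E) →* _) (hsurj x) (hsurj τ)]
    simp
  rw [← Nat.card_eq_fintype_card, ← Nat.card_eq_fintype_card, IsGalois.card_aut_eq_finrank,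
    IsGalois.card_aut_eq_finrank, ← Module.finrank_mul_finrank K F E] at h1
  exact (Nat.eq_of_mul_eq_mul_left Module.finrank_pos h1).symm

/-- Tate's form of Herbrand's lemma on the ramification function of a quotient. -/
theorem sum_fiber_map_sub [IsGalois K E] (hE : IsTotRamUniformizer K wE tE)
    (hF : IsTotRamUniformizer K wF tF)
    (hcomp : ∀ x, wE (algebraMap F E x) = Module.finrank F E • wF x)
    [DecidableEq (F ≃ₐ[K] F)] (τ : F ≃ₐ[K] F) :
    ∑ s : E ≃ₐ[K] E with AlgEquiv.restrictNormalHom F s = τ, wE (s tE - tE) =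
      Module.finrank F E • wF (τ tF - tF) := by
  have : FiniteDimensional K F := FiniteDimensional.left K F E
  have : FiniteDimensional F E := FiniteDimensional.right K F E
  set S := Finset.univ.filter fun s : E ≃ₐ[K] E => AlgEquiv.restrictNormalHom F s = τ with hS
  have hres : ∀ s ∈ S, ∀ x : F, s (algebraMap F E x) = algebraMap F E (τ x) := by
    intro s hs x
    rw [hS, Finset.mem_filter] at hs
    rw [← hs.2]
    exact (AlgEquiv.restrictNormal_commutes s F x).symm
  have htE : 0 ≤ wE tE := by rw [hE.1]; exact zero_le_one
  apply le_antisymm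
  · obtain ⟨g, -, hg0, hg⟩ := hE.exists_aeval_eq (y := algebraMap F E tF) (by
      rw [hcomp, hF.1]; exact nsmul_nonneg zero_le_one _)
    have hτ : 0 ≤ wE (algebraMap F E (τ tF)) := by
      rw [hcomp]; exact nsmul_nonneg (hF.map_apply_uniformizer_nonneg τ) _
    have h := wE.sum_map_sub_le_map_eval (s := S)
      (P := g.map (algebraMap K E) - C (algebraMap F E (τ tF))) (fun k => ?_)
      hE.injective_apply.injOn
      (fun s _ => hE.map_apply_uniformizer_nonneg s) (fun s hs => ?_) htE
    · rw [eval_sub, eval_C, eval_map_algebraMap, hg, ← _root_.map_sub, hcomp,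
        wF.map_sub_swap] at h
      simpa only [wE.map_sub_swap tE] using h
    · rw [coeff_sub, coeff_map, coeff_C]
      refine wE.map_le_sub (hg0 k) ?_
      split_ifs
      · exact hτ
      · simp
    · rw [IsRoot.def, eval_sub, eval_C, eval_map_algebraMap, Polynomial.aeval_algHom_apply, hg,
        hres s hs, sub_self]
  · obtain ⟨g, hgdeg, hg0, hg⟩ := (hE.of_tower hcomp).exists_aeval_eq
      (y := tE ^ Module.finrank F E) (by rw [wE.map_pow]; exact nsmul_nonneg htE _)
    set N := Module.finrank F E with hN
    have hg0' : ∀ k, 0 ≤ wF (g.coeff k) := by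
      intro k
      by_contra! hneg
      have h := hg0 k
      obtain ⟨c, hc⟩ := WithTop.ne_top_iff_exists.1 hneg.ne_top
      rw [hcomp, ← hc, ← WithTop.coe_nsmul, nsmul_eq_mul] at h
      rw [← hc] at hneg
      norm_cast at h hneg
      exact absurd h (not_le.2 (mul_neg_of_pos_of_neg
        (by exact_mod_cast (Module.finrank_pos : 0 < Module.finrank F E)) hneg))
    set P : E[X] := X ^ N - (g.map (τ : F →+* F)).map (algebraMap F E) with hP
    have hdeg : ((g.map (τ : F →+* F)).map (algebraMap F E)).degree < N := by
      rw [degree_map, degree_map]; exact hgdeg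
    have hPmonic : P.Monic := monic_X_pow_sub hdeg
    have hPdeg : P.natDegree = N := natDegree_eq_of_degree_eq_some (by
      rw [hP, degree_sub_eq_left_of_degree_lt (by rwa [degree_X_pow]), degree_X_pow])
    have hPeval : ∀ y, P.eval y = y ^ N - ∑ k ∈ Finset.range (g.natDegree + 1),
        algebraMap F E (τ (g.coeff k)) * y ^ k := by
      intro y
      rw [hP, eval_sub, eval_pow, eval_X, eval_map_algebraMap, aeval_def, eval₂_map,
        eval₂_eq_sum_range]
      rfl
    rw [aeval_eq_sum_range] at hg
    simp only [Algebra.smul_def] at hg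
    have hroot : ∀ s ∈ S, P.IsRoot (s tE) := by
      intro s hs
      rw [IsRoot.def, hPeval, ← _root_.map_pow, ← hg, _root_.map_sum, ← Finset.sum_sub_distrib]
      refine Finset.sum_eq_zero fun k _ => ?_
      rw [_root_.map_mul, hres s hs, _root_.map_pow, sub_self]
    have hval : ∑ s ∈ S, wE (s tE - tE) = wE (P.eval tE) := by
      rw [hPmonic.eval_eq_prod_of_isRoot hE.injective_apply.injOn hroot
        (by rw [hPdeg, hS, card_fiber_restrictNormalHom]), wE.map_prod_withTop]
      simp only [wE.map_sub_swap tE]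
    rw [hval, hPeval, ← hg, ← Finset.sum_sub_distrib]
    refine wE.map_le_sum fun k _ => ?_
    rw [← sub_mul, ← _root_.map_sub, wE.map_mul, hcomp, wF.map_sub_swap (g.coeff k), wE.map_pow]
    exact le_add_of_le_of_nonneg (nsmul_le_nsmul_right (hF.map_sub_le τ (hg0' k)) N)
      (nsmul_nonneg htE k)

end Tower

end IsTotRamUniformizer

/-- In a cyclic `p`-group, a subgroup of order `p` is contained in every nontrivial subgroup. -/
theorem IsCyclic.le_of_card_eq_prime {G : Type*} [Group G] [Finite G] [IsCyclic G] {p k : ℕ}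
    [Fact p.Prime] (hG : Nat.card G = p ^ k) {N Γ : Subgroup G} (hN : Nat.card N = p)
    (hΓ : Γ ≠ ⊥) : N ≤ Γ := by
  classical
  have := Fintype.ofFinite G
  have hp : p.Prime := Fact.out
  have hdvd : p ∣ Nat.card Γ := by
    obtain ⟨l, -, hl⟩ := (Nat.dvd_prime_pow hp).1 (hG ▸ Subgroup.card_subgroup_dvd_card Γ)
    rw [hl]
    refine dvd_pow_self p fun h0 => hΓ ?_
    rw [h0, pow_zero] at hl
    exact Subgroup.card_eq_one.1 hl
  obtain ⟨x, hx⟩ := exists_prime_orderOf_dvd_card' p hdvd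
  have hsub : (N : Set G).toFinset ⊆ Finset.univ.filter fun g : G => g ^ p = 1 := by
    intro g hg
    rw [Set.mem_toFinset] at hg
    have h : (⟨g, hg⟩ : N) ^ p = 1 := hN ▸ pow_card_eq_one'
    simpa [Subtype.ext_iff] using h
  have heq := Finset.eq_of_subset_of_card_le hsub (by
    refine (IsCyclic.card_pow_eq_one_le hp.pos).trans ?_
    rw [Set.toFinset_card, ← Nat.card_eq_fintype_card]
    exact hN.ge)
  have hxN : (x : G) ∈ N := by
    have : (x : G) ∈ (N : Set G).toFinset := by
      rw [heq]
      simp only [Finset.mem_filter, Finset.mem_univ, true_and]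
      have hxp := pow_orderOf_eq_one x
      rw [hx] at hxp
      exact_mod_cast hxp
    simpa using this
  intro g hg
  have hx1 : (⟨x, hxN⟩ : N) ≠ 1 := by
    intro h
    have h1 : x = 1 := Subtype.ext (congrArg (Subtype.val : N → G) h)
    rw [h1, orderOf_one] at hx
    exact hp.one_lt.ne hx
  obtain ⟨l, hl⟩ := mem_zpowers_of_prime_card hN hx1 (g' := ⟨g, hg⟩)
  have : g = (x : G) ^ l := by simpa [Subtype.ext_iff] using hl.symm
  rw [this]
  exact Γ.zpow_mem x.2 l

namespace IsTotRamUniformizer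

section RamificationIndex

variable {K E : Type*} [Field K] [Field E] [Algebra K E]

open Classical in
/-- The function `σ ↦ w (σ t - t)` on a Galois group, with the value `e + 1` at the identity. -/
noncomputable def ramIndex (w : AddValuation E (WithTop ℤ)) (t : E) (e : ℕ) (σ : E ≃ₐ[K] E) : ℕ :=
  if σ = 1 then e + 1 else ((w (σ t - t)).untopD 0).toNat

theorem ramIndex_one (w : AddValuation E (WithTop ℤ)) (t : E) (e : ℕ) :
    ramIndex w t e (1 : E ≃ₐ[K] E) = e + 1 := by
  simp [ramIndex]

variable [FiniteDimensional K E] {w : AddValuation E (WithTop ℤ)} {t : E}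

/-- The lower ramification groups of a totally ramified extension, as subgroups. -/
def ramSubgroup (h : IsTotRamUniformizer K w t) (i : ℕ) : Subgroup (E ≃ₐ[K] E) where
  carrier := ramGroup w t i
  one_mem' := by simp [ramGroup]
  mul_mem' := by
    intro σ τ hσ hτ
    have h0 : 0 ≤ w (τ t - t) := le_trans (by norm_cast; positivity) hτ
    have : (σ * τ) t - t = σ (τ t - t) + (σ t - t) := by
      rw [AlgEquiv.mul_apply, _root_.map_sub]; ring
    change _ ≤ w _
    rw [this]
    exact w.map_le_add (hτ.trans (h.le_map_apply σ h0)) hσ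
  inv_mem' := by
    intro σ hσ
    have h0 : 0 ≤ w (σ t - t) := le_trans (by norm_cast; positivity) hσ
    have : σ⁻¹ t - t = -(σ⁻¹ (σ t - t)) := by
      rw [_root_.map_sub, show σ⁻¹ (σ t) = t from σ.symm_apply_apply t]; ring
    change _ ≤ w _
    rw [this, w.map_neg]
    exact hσ.trans (h.le_map_apply σ⁻¹ h0)

theorem coe_ramIndex (h : IsTotRamUniformizer K w t) (e : ℕ) {σ : E ≃ₐ[K] E} (hσ : σ ≠ 1) :
    ((ramIndex w t e σ : ℤ) : WithTop ℤ) = w (σ t - t) := by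
  have hne : σ t - t ≠ 0 := sub_ne_zero.2 fun h0 => hσ (h.eq_one_of_apply_eq h0)
  obtain ⟨c, hc⟩ := WithTop.ne_top_iff_exists.1 ((w.ne_top_iff).2 hne)
  have h0 : 0 ≤ w (σ t - t) := w.map_le_sub (h.map_apply_uniformizer_nonneg σ)
    (by rw [h.1]; exact zero_le_one)
  rw [← hc] at h0
  norm_cast at h0
  rw [ramIndex, if_neg hσ, ← hc, WithTop.untopD_coe, Int.toNat_of_nonneg h0]

theorem mem_ramGroup_iff (h : IsTotRamUniformizer K w t) {e j : ℕ} (hj : j ≤ e)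
    (σ : E ≃ₐ[K] E) : σ ∈ ramGroup w t j ↔ j < ramIndex w t e σ := by
  by_cases hσ : σ = 1
  · subst hσ
    rw [ramIndex_one]
    exact iff_of_true (h.ramSubgroup j).one_mem (by omega)
  · change (((j : ℤ) + 1 : ℤ) : WithTop ℤ) ≤ w (σ t - t) ↔ _
    rw [← h.coe_ramIndex e hσ, WithTop.coe_le_coe]
    omega

theorem ramIndex_le (h : IsTotRamUniformizer K w t) {e : ℕ}
    (he : ramGroup (K := K) w t (e + 1) = {1}) (σ : E ≃ₐ[K] E) : ramIndex w t e σ ≤ e + 1 := by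
  by_cases hσ : σ = 1
  · rw [hσ, ramIndex_one]
  · by_contra! hlt
    have : σ ∈ ramGroup (K := K) w t (e + 1) := by
      change (((e + 1 : ℕ) + 1 : ℤ) : WithTop ℤ) ≤ w (σ t - t)
      rw [← h.coe_ramIndex e hσ, WithTop.coe_le_coe]
      omega
    rw [he] at this
    exact hσ this

theorem sum_ncard_ramGroup (h : IsTotRamUniformizer K w t) {e : ℕ}
    (he : ramGroup (K := K) w t (e + 1) = {1}) :
    ∑ j ∈ Finset.range (e + 1), (ramGroup (K := K) w t j).ncard =
      ∑ σ : E ≃ₐ[K] E, ramIndex w t e σ := by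
  have h1 : ∀ j ∈ Finset.range (e + 1), (ramGroup (K := K) w t j).ncard =
      ∑ σ : E ≃ₐ[K] E, if j < ramIndex w t e σ then 1 else 0 := by
    intro j hj
    rw [Finset.mem_range] at hj
    rw [← Finset.card_filter, ← Set.ncard_coe_finset]
    congr 1
    ext σ
    simp [h.mem_ramGroup_iff (Nat.lt_succ_iff.1 hj)]
  rw [Finset.sum_congr rfl h1, Finset.sum_comm]
  refine Finset.sum_congr rfl fun σ _ => ?_
  rw [← Finset.card_filter]
  have := h.ramIndex_le he σ
  rw [show (Finset.range (e + 1)).filter (fun j => j < ramIndex w t e σ) =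
    Finset.range (ramIndex w t e σ) by ext j; simp; omega, Finset.card_range]

end RamificationIndex

theorem sum_ramIndex_tower {K F E : Type*} [Field K] [Field F] [Field E] [Algebra K F]
    [Algebra K E] [FiniteDimensional K F] [FiniteDimensional K E] [IsGalois K F] [IsGalois K E] [IsCyclic (E ≃ₐ[K] E)]
    {p k e e' : ℕ} [Fact p.Prime] (hdeg : Module.finrank K E = p ^ k)
    (hdeg' : Module.finrank K E = Module.finrank K F * p) (f : F →ₐ[K] E)
    {wE : AddValuation E (WithTop ℤ)} {tE : E} {wF : AddValuation F (WithTop ℤ)} {tF : F}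
    (hE : IsTotRamUniformizer K wE tE)
    (hF : IsTotRamUniformizer K wF tF)
    (hcomp : ∀ x, wE (f x) = p • wF x)
    (he : ramGroup (K := K) wE tE e ≠ {1}) (he1 : ramGroup (K := K) wE tE (e + 1) = {1}) :
    ∑ σ : E ≃ₐ[K] E, ramIndex wE tE e σ + p * (e' + 1) =
      p * ∑ τ : F ≃ₐ[K] F, ramIndex wF tF e' τ + p * (e + 1) := by
  classical
  let _ : Algebra F E := f.toRingHom.toAlgebra
  have : IsScalarTower K F E := IsScalarTower.of_algebraMap_eq fun x => (f.commutes x).symm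
  have hp : Module.finrank F E = p := by
    rw [← Module.finrank_mul_finrank K F E] at hdeg'
    exact Nat.eq_of_mul_eq_mul_left Module.finrank_pos hdeg'
  let res : (E ≃ₐ[K] E) →* (F ≃ₐ[K] F) := AlgEquiv.restrictNormalHom F
  have hfib : ∀ τ ∈ Finset.univ.erase (1 : F ≃ₐ[K] F),
      ∑ σ with res σ = τ, ramIndex wE tE e σ = p * ramIndex wF tF e' τ := by
    intro τ hτ
    have hτ1 : τ ≠ 1 := (Finset.mem_erase.1 hτ).1
    have h := hE.sum_fiber_map_sub hF (fun x => by rw [hp]; exact hcomp x) τ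
    rw [hp, ← hF.coe_ramIndex e' hτ1, Finset.sum_congr rfl fun s hs => (hE.coe_ramIndex e
      (fun hs1 => hτ1 (by rw [← (Finset.mem_filter.1 hs).2, hs1, _root_.map_one]))).symm] at h
    rw [← WithTop.coe_sum, ← WithTop.coe_nsmul, WithTop.coe_inj, nsmul_eq_mul] at h
    exact_mod_cast h
  have hker : Nat.card res.ker = p := by
    have h := card_fiber_restrictNormalHom (K := K) (E := E) (1 : F ≃ₐ[K] F)
    rw [hp, ← Set.ncard_coe_finset] at h
    rw [← h, ← Nat.card_coe_set_eq]
    congr 2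
    ext σ
    simp [res, MonoidHom.mem_ker]
  have hle : res.ker ≤ hE.ramSubgroup e :=
    IsCyclic.le_of_card_eq_prime (by rw [IsGalois.card_aut_eq_finrank, hdeg]) hker fun hbot =>
      he (by rw [← Subgroup.coe_bot, ← hbot]; rfl)
  have hone : ∑ σ with res σ = 1, ramIndex wE tE e σ = p * (e + 1) := by
    have hval : ∀ σ ∈ Finset.univ.filter fun σ : E ≃ₐ[K] E => res σ = 1,
        ramIndex wE tE e σ = e + 1 := by
      intro σ hσ
      have hmem : σ ∈ ramGroup wE tE e := hle (Finset.mem_filter.1 hσ).2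
      rw [hE.mem_ramGroup_iff le_rfl] at hmem
      exact le_antisymm (hE.ramIndex_le he1 σ) hmem
    rw [Finset.sum_congr rfl hval, Finset.sum_const, smul_eq_mul, ← hp]
    exact congrArg (· * (e + 1))
      (card_fiber_restrictNormalHom (K := K) (F := F) (E := E) 1)
  rw [← Finset.sum_fiberwise Finset.univ res, ← Finset.add_sum_erase _ _ (Finset.mem_univ 1),
    hone, Finset.sum_congr rfl hfib, ← Finset.add_sum_erase Finset.univ (ramIndex wF tF e')
    (Finset.mem_univ 1), ramIndex_one, ← Finset.mul_sum]
  ring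

end IsTotRamUniformizer

theorem IsAddValuation.exists_addValuation {L : Type*} [Field L] {v : L → WithTop ℤ}
    (hv : IsAddValuation v) : ∃ w : AddValuation L (WithTop ℤ), ⇑w = v := by
  refine ⟨AddValuation.of v ((hv.1 0).2 rfl) ?_ hv.2.2 hv.2.1, rfl⟩
  have h1 : v 1 ≠ ⊤ := fun h => one_ne_zero ((hv.1 1).1 h)
  obtain ⟨c, hc⟩ := WithTop.ne_top_iff_exists.1 h1
  have h := hv.2.1 1 1
  rw [mul_one, ← hc] at h
  rw [← hc]
  norm_cast at h ⊢
  omega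

theorem WithTop.natCast_pow_mul_coe (p k : ℕ) (c : ℤ) :
    (p : WithTop ℤ) ^ k * (c : WithTop ℤ) = ((p ^ k * c : ℤ) : WithTop ℤ) := by
  norm_cast

/-- The telescoping identities that follow from a one-step recursion. -/
theorem telescope_of_step {p n : ℕ} {e m : ℕ → ℚ} (hm0 : m 0 = 0) (he0 : e 0 = 0)
    (hstep : ∀ i < n, (p : ℚ) ^ i * (m (i + 1) - m i) = e (i + 1) - e i) :
    e n = ∑ i ∈ Finset.Icc 1 n, (p : ℚ) ^ (i - 1) * (m i - m (i - 1)) ∧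
    p ^ n * m n - e n = ∑ i ∈ Finset.Icc 1 n, ((p : ℚ) ^ i - (p : ℚ) ^ (i - 1)) * m i := by
  induction n with
  | zero => simp [hm0, he0]
  | succ k ih =>
    obtain ⟨h1, h2⟩ := ih fun i hi => hstep i (by omega)
    have h := hstep k (by omega)
    rw [Finset.sum_Icc_succ_top (by omega), Finset.sum_Icc_succ_top (by omega), ← h1, ← h2,
      Nat.add_sub_cancel, pow_succ]
    constructor
    · linear_combination -h
    · linear_combination h

end Ramification

/-- Let `K` be a complete discretely valued field with perfect residue field of
characteristic `p > 0`, and `L_n/K` cyclic totally ramified of degree `p^n`. For `0 ≤ i ≤ n`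
let `L_i` be the unique intermediate field with `[L_i : K] = p^i` (here `L_i` is the fixed
field of the unique subgroup `H_i` of order `p^{n−i}`), and set `m_i = m(L_i/K)`,
`e_i = e(L_i/K)`, `μ_i = μ(L_i/K)` (with `m_0 = e_0 = μ_0 = 0`). Then
`e_n = Σ_{i=1}^{n} p^{i−1}(m_i − m_{i−1})` and `μ_n = Σ_{i=1}^{n} (p^i − p^{i−1}) m_i`. -/
theorem e_and_mu_telescope (p n : ℕ) [Fact p.Prime] (K M : Type*) [Field K] [Field M]
    [Algebra K M] [IsGalois K M] [FiniteDimensional K M] [IsCyclic (M ≃ₐ[K] M)]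
    (hdeg : Module.finrank K M = p ^ n)
    -- the subgroups cutting out the tower `L_i = fixedField (H i)`
    (H : ℕ → Subgroup (M ≃ₐ[K] M)) (hH : ∀ i ≤ n, Nat.card (H i) = p ^ (n - i))
    (hchain : ∀ i j, i ≤ j → j ≤ n → H j ≤ H i)
    -- the normalized valuations and uniformizers of the `L_i`
    (v : (i : ℕ) → ↥(IntermediateField.fixedField (H i)) → WithTop ℤ)
    (hv : ∀ i ≤ n, IsAddValuation (v i))
    (t : (i : ℕ) → ↥(IntermediateField.fixedField (H i)))
    (ht : ∀ i ≤ n, v i (t i) = 1)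
    -- compatibility of the valuations in the tower
    (hcomp : ∀ i j, i ≤ j → j ≤ n →
      ∀ (x : ↥(IntermediateField.fixedField (H i)))
        (x' : ↥(IntermediateField.fixedField (H j))), (x : M) = (x' : M) →
        v j x' = ((p : WithTop ℤ)) ^ (j - i) * v i x)
    -- `K` is complete
    (hcompl : ∀ x : ℕ → K,
      (∀ c : ℤ, ∃ N : ℕ, ∀ i ≥ N, ∀ j ≥ N,
        (c : WithTop ℤ) ≤ v n (algebraMap K _ (x i - x j))) →
      ∃ a : K, ∀ c : ℤ, ∃ N : ℕ, ∀ i ≥ N, (c : WithTop ℤ) ≤ v n (algebraMap K _ (x i - a)))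
    -- the residue characteristic is `p` and the residue field is perfect
    (hresp : (0 : WithTop ℤ) < v n (p : ↥(IntermediateField.fixedField (H n))))
    (hperf : ∀ x : ↥(IntermediateField.fixedField (H n)), 0 ≤ v n x →
      ∃ z, 0 < v n (x - z ^ p))
    -- `L_n/K` is totally ramified of degree `p^n`
    (htr : ∀ x : K, x ≠ 0 → ∃ a : ℤ,
      v n (algebraMap K _ x) = ((p ^ n * a : ℤ) : WithTop ℤ))
    -- `e i = e(L_i/K)` is the largest integer with `(Gal(L_i/K))_{e i} ≠ {1}`
    (e : ℕ → ℕ)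
    (he : ∀ i ≤ n, 1 ≤ i → ramGroup (K := K) (v i) (t i) (e i) ≠ {1})
    (he' : ∀ i ≤ n, ∀ j, e i < j → ramGroup (K := K) (v i) (t i) j = {1})
    -- `m i = m(L_i/K)` is the conductor exponent of `L_i/K`
    (m : ℕ → ℚ)
    (hm : ∀ i ≤ n, 1 ≤ i → m i =
      (∑ j ∈ Finset.range (e i + 1), ((ramGroup (K := K) (v i) (t i) j).ncard : ℚ)) / p ^ i - 1)
    -- `d i = deg𝔇_{L_i/K}` (Hilbert's formula) and `μ i = μ(L_i/K) = d i − p^i + 1`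
    (d : ℕ → ℕ)
    (hd : ∀ i ≤ n, 1 ≤ i → d i =
      ∑ j ∈ Finset.range (e i + 1), ((ramGroup (K := K) (v i) (t i) j).ncard - 1))
    (μ : ℕ → ℚ) (hμ : ∀ i ≤ n, 1 ≤ i → μ i = (d i : ℚ) - p ^ i + 1)
    (h0 : m 0 = 0 ∧ e 0 = 0 ∧ μ 0 = 0)
    (hn : 1 ≤ n) :
    (e n : ℚ) = ∑ i ∈ Finset.Icc 1 n, (p : ℚ) ^ (i - 1) * (m i - m (i - 1)) ∧
    μ n = ∑ i ∈ Finset.Icc 1 n, ((p : ℚ) ^ i - (p : ℚ) ^ (i - 1)) * m i := by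
  have hp : p.Prime := Fact.out
  let L : ℕ → IntermediateField K M := fun i => IntermediateField.fixedField (H i)
  have hfin : ∀ i ≤ n, Module.finrank K (L i) = p ^ i := by
    intro i hi
    have h := Module.finrank_mul_finrank K (L i) M
    rw [IntermediateField.finrank_fixedField_eq_card, hH i hi, hdeg] at h
    refine Nat.eq_of_mul_eq_mul_right (pow_pos hp.pos (n - i)) ?_
    rw [h, ← pow_add, Nat.add_sub_cancel' hi]
  have hw : ∀ i, ∃ w : AddValuation (L i) (WithTop ℤ), i ≤ n → ⇑w = v i := by
    intro i
    by_cases hi : i ≤ n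
    · obtain ⟨w, hw⟩ := (hv i hi).exists_addValuation
      exact ⟨w, fun _ => hw⟩
    · classical exact ⟨AddValuation.ofValuation 1, fun h => absurd h hi⟩
  choose w hw using hw
  have hram : ∀ i ≤ n, IsTotRamUniformizer K (w i) (t i) := by
    intro i hi
    refine ⟨by rw [hw i hi]; exact ht i hi, fun x hx => ?_⟩
    rw [hw i hi]
    obtain ⟨a, ha⟩ := htr x hx
    refine ⟨a, ?_⟩
    rw [hcomp i n hi le_rfl (algebraMap K _ x) (algebraMap K _ x) rfl] at ha
    have hne : v i (algebraMap K _ x) ≠ ⊤ := fun h => hx (by simpa using ((hv i hi).1 _).1 h)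
    obtain ⟨c, hc⟩ := WithTop.ne_top_iff_exists.1 hne
    rw [← hc, WithTop.natCast_pow_mul_coe, WithTop.coe_inj] at ha
    rw [← hc, hfin i hi]
    have hpow : (p : ℤ) ^ n = p ^ (n - i) * p ^ i := by rw [← pow_add, Nat.sub_add_cancel hi]
    rw [hpow, mul_assoc] at ha
    have hp0 : (p : ℤ) ^ (n - i) ≠ 0 := pow_ne_zero _ (by exact_mod_cast hp.ne_zero)
    rw [mul_left_cancel₀ hp0 ha]
    push_cast
    rfl
  have hcyc : ∀ i, IsCyclic (L i ≃ₐ[K] L i) := fun i =>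
    isCyclic_of_surjective (AlgEquiv.restrictNormalHom (L i) : (M ≃ₐ[K] M) →* _)
      (AlgEquiv.restrictNormalHom_surjective M)
  let S : ℕ → ℕ := fun i => ∑ σ : L i ≃ₐ[K] L i, IsTotRamUniformizer.ramIndex (w i) (t i) (e i) σ
  have hlast : ∀ i ≤ n, ramGroup (K := K) (w i) (t i) (e i + 1) = {1} := by
    intro i hi
    rw [hw i hi]
    exact he' i hi _ (Nat.lt_succ_self _)
  have hS : ∀ i ≤ n, 1 ≤ i → ∑ j ∈ Finset.range (e i + 1),
      (ramGroup (K := K) (v i) (t i) j).ncard = S i := by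
    intro i hi _
    rw [← hw i hi]
    exact (hram i hi).sum_ncard_ramGroup (hlast i hi)
  have hmS : ∀ i ≤ n, (p : ℚ) ^ i * (m i + 1) = S i := by
    intro i hi
    rcases Nat.eq_zero_or_pos i with rfl | hi1
    · have : Subsingleton (L 0 ≃ₐ[K] L 0) := by
        rw [← Finite.card_le_one_iff_subsingleton, IsGalois.card_aut_eq_finrank, hfin 0 hi,
          pow_zero]
      have huniv : (Finset.univ : Finset (L 0 ≃ₐ[K] L 0)) = {1} := by
        ext σ; simp [Subsingleton.elim σ 1]
      simp [S, huniv, IsTotRamUniformizer.ramIndex_one, h0]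
    · rw [hm i hi hi1, ← hS i hi hi1, sub_add_cancel, mul_div_cancel₀]
      · push_cast; rfl
      · exact pow_ne_zero _ (by exact_mod_cast hp.ne_zero)
  have hstep : ∀ i < n, (p : ℚ) ^ i * (m (i + 1) - m i) = (e (i + 1) : ℚ) - e i := by
    intro i hi
    have hle : L i ≤ L (i + 1) :=
      IntermediateField.fixedField_antitone (hchain i (i + 1) (by omega) hi)
    have hrec : S (i + 1) + p * (e i + 1) = p * S i + p * (e (i + 1) + 1) := by
      refine IsTotRamUniformizer.sum_ramIndex_tower (k := i + 1) (hfin (i + 1) hi)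
        (by rw [hfin (i + 1) hi, hfin i hi.le, pow_succ]) (IntermediateField.inclusion hle)
        (hram (i + 1) hi) (hram i hi.le) (fun x => ?_) ?_ (hlast (i + 1) hi)
      · rw [hw (i + 1) hi, hw i hi.le, hcomp i (i + 1) (by omega) hi x _ rfl]
        by_cases hx : x = 0
        · subst hx
          rw [((hv i hi.le).1 0).2 rfl, Nat.add_sub_cancel_left, pow_one,
            WithTop.mul_top (by exact_mod_cast hp.ne_zero), ← Nat.sub_add_cancel hp.one_le, succ_nsmul,
            WithTop.add_top]
        · obtain ⟨c, hc⟩ := WithTop.ne_top_iff_exists.1 (fun h => hx (((hv i hi.le).1 x).1 h))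
          rw [← hc, WithTop.natCast_pow_mul_coe, ← WithTop.coe_nsmul, nsmul_eq_mul,
            Nat.add_sub_cancel_left, pow_one]
      · rw [hw (i + 1) hi]
        exact he (i + 1) hi (by omega)
    have hrec' : (S (i + 1) : ℚ) + p * (e i + 1) = p * S i + p * (e (i + 1) + 1) := by
      exact_mod_cast hrec
    rw [← hmS i hi.le, ← hmS (i + 1) hi, pow_succ] at hrec'
    have hp0 : (p : ℚ) ≠ 0 := by exact_mod_cast hp.ne_zero
    refine mul_left_cancel₀ hp0 ?_
    linear_combination hrec'
  obtain ⟨h1, h2⟩ := telescope_of_step (e := fun i => (e i : ℚ)) h0.1 (by simp [h0]) hstep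
  refine ⟨h1, ?_⟩
  rw [← h2, hμ n le_rfl hn, hd n le_rfl hn]
  have hsub : ∑ j ∈ Finset.range (e n + 1), ((ramGroup (K := K) (v n) (t n) j).ncard - 1) +
      (e n + 1) = S n := by
    rw [← hS n le_rfl hn]
    have hone : e n + 1 = ∑ _j ∈ Finset.range (e n + 1), 1 := by simp
    nth_rewrite 2 [hone]
    rw [← Finset.sum_add_distrib]
    refine Finset.sum_congr rfl fun j _ => Nat.sub_add_cancel ?_
    rw [← hw n le_rfl]
    refine (Set.ncard_pos (Set.toFinite _)).2 ?_
    exact ⟨1, ((hram n le_rfl).ramSubgroup j).one_mem⟩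
  have hsub' := congrArg (Nat.cast (R := ℚ)) hsub
  rw [← hmS n le_rfl] at hsub'
  push_cast at hsub' ⊢
  linear_combination hsub'
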